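/- arXiv:2502.08032 — 2 statements merged into one kernel-verified Lean document; each statement's English description precedes it below -/
import Mathlib

section
/- Let G=(V,E) be a digraph with n vertices and let G' be its condensation. If G' admits an (s',d')-shortcut, then there exists a set E'' ⊆ E^T∖E with |E''| ≤ s' + 2n such that the graph (V, E∪E'') has diameter at most 3d' + 2. -/
/-- The adjacency relation of a digraph given by its edge set. -/
def digAdj {V : Type*} (E : Set (V × V)) : V → V → Prop := fun u v => (u, v) ∈ E

/-- Reachability (directed path of length ≥ 0). -/
def digReach {V : Type*} (E : Set (V × V)) : V → V → Prop :=
  Relation.ReflTransGen (digAdj E)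

/-- The transitive-closure edge set: pairs joined by a directed path of length ≥ 1. -/
def digTC {V : Type*} (E : Set (V × V)) : Set (V × V) :=
  {p | Relation.TransGen (digAdj E) p.1 p.2}

/-- There is a directed walk of length `n` from `u` to `v`. -/
def hasWalk {V : Type*} (E : Set (V × V)) (u v : V) (n : ℕ) : Prop :=
  ∃ f : ℕ → V, f 0 = u ∧ f n = v ∧ ∀ i < n, (f i, f (i + 1)) ∈ E

/-- The distance from `u` to `v` (number of edges of a shortest directed path; `⊤` if none). -/
noncomputable def digDist {V : Type*} (E : Set (V × V)) (u v : V) : ℕ∞ :=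
  sInf {n : ℕ∞ | ∃ m : ℕ, hasWalk E u v m ∧ n = (m : ℕ∞)}

/-- The graph has diameter at most `d`: every reachable pair is at distance ≤ `d`. -/
def diamLE {V : Type*} (E : Set (V × V)) (d : ℕ) : Prop :=
  ∀ u v : V, (u, v) ∈ digTC E → digDist E u v ≤ (d : ℕ∞)

/-- `E'` is an `(s,d)`-shortcut of the digraph with edge set `E`. -/
def IsShortcut {V : Type*} (E E' : Set (V × V)) (s d : ℕ) : Prop :=
  E' ⊆ digTC E \ E ∧ E'.ncard ≤ s ∧ diamLE (E ∪ E') d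

/-- `E''` is an `(s,d)`-TC spanner of the digraph with edge set `E`. -/
def IsTCSpanner {V : Type*} (E E'' : Set (V × V)) (s d : ℕ) : Prop :=
  E'' ⊆ digTC E ∧ E''.ncard ≤ s ∧ digTC E'' = digTC E ∧ diamLE E'' d

/-- A digraph is acyclic if no vertex lies on a directed cycle. -/
def digAcyclic {V : Type*} (E : Set (V × V)) : Prop :=
  ∀ v : V, ¬ Relation.TransGen (digAdj E) v v

/-- The set of vertices lying on some directed path from `u` to `v`. -/
def digBetween {V : Type*} (E : Set (V × V)) (u v : V) : Set V :=
  {w | digReach E u w ∧ digReach E w v}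

/-- The setoid identifying vertices in the same strongly connected component. -/
def sccSetoid {V : Type*} (E : Set (V × V)) : Setoid V where
  r u v := digReach E u v ∧ digReach E v u
  iseqv := ⟨fun _ => ⟨Relation.ReflTransGen.refl, Relation.ReflTransGen.refl⟩,
    fun h => ⟨h.2, h.1⟩, fun h₁ h₂ => ⟨h₁.1.trans h₂.1, h₂.2.trans h₁.2⟩⟩

/-- The edge set of the condensation of a digraph: an edge from `C` to `C'` (`C ≠ C'`) iff
there is an edge of `G` from a vertex of `C` to a vertex of `C'`. -/
def condEdges {V : Type*} (E : Set (V × V)) :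
    Set (Quotient (sccSetoid E) × Quotient (sccSetoid E)) :=
  {p | p.1 ≠ p.2 ∧ ∃ u v : V, (u, v) ∈ E ∧
    Quotient.mk (sccSetoid E) u = p.1 ∧ Quotient.mk (sccSetoid E) v = p.2}

/-- There is a directed walk of length at most `k` from `u` to `v`. -/
def hasWalkLE {V : Type*} (E : Set (V × V)) (u v : V) (k : ℕ) : Prop :=
  ∃ m ≤ k, hasWalk E u v m

theorem hasWalkLE.refl {V : Type*} (E : Set (V × V)) (u : V) (k : ℕ) : hasWalkLE E u u k :=
  ⟨0, Nat.zero_le k, fun _ => u, rfl, rfl, by simp⟩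

theorem hasWalkLE.of_edge {V : Type*} {E : Set (V × V)} {u v : V} (h : (u, v) ∈ E) :
    hasWalkLE E u v 1 := by
  refine ⟨1, le_rfl, fun i => if i = 0 then u else v, by simp, by simp, ?_⟩
  intro i hi
  obtain rfl : i = 0 := by omega
  simpa using h

theorem hasWalk.trans {V : Type*} {E : Set (V × V)} {u v w : V} {m n : ℕ}
    (h₁ : hasWalk E u v m) (h₂ : hasWalk E v w n) : hasWalk E u w (m + n) := by
  obtain ⟨f, hf0, hfm, hf⟩ := h₁
  obtain ⟨g, hg0, hgn, hg⟩ := h₂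
  refine ⟨fun i => if i < m then f i else g (i - m), ?_, by simp [hgn], ?_⟩
  · rcases Nat.eq_zero_or_pos m with rfl | hm
    · simp [hg0, ← hfm, hf0]
    · simp [hm, hf0]
  · intro i hi
    rcases lt_trichotomy (i + 1) m with h | h | h
    · simpa [h, show i < m by omega] using hf i (by omega)
    · have := hf i (by omega)
      rw [h, hfm, ← hg0] at this
      simpa [h, show i < m by omega] using this
    · have := hg (i - m) (by omega)
      simpa [show ¬ i < m by omega, show ¬ i + 1 < m by omega,
        show i + 1 - m = i - m + 1 by omega] using this

theorem hasWalkLE.trans {V : Type*} {E : Set (V × V)} {u v w : V} {k l : ℕ}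
    (h₁ : hasWalkLE E u v k) (h₂ : hasWalkLE E v w l) : hasWalkLE E u w (k + l) := by
  obtain ⟨m, hm, hw₁⟩ := h₁
  obtain ⟨n, hn, hw₂⟩ := h₂
  exact ⟨m + n, Nat.add_le_add hm hn, hw₁.trans hw₂⟩

theorem hasWalkLE.mono {V : Type*} {E : Set (V × V)} {u v : V} {k l : ℕ}
    (h : hasWalkLE E u v k) (hkl : k ≤ l) : hasWalkLE E u v l := by
  obtain ⟨m, hm, hw⟩ := h
  exact ⟨m, hm.trans hkl, hw⟩

theorem digDist_le_iff {V : Type*} {E : Set (V × V)} {u v : V} {k : ℕ} :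
    digDist E u v ≤ k ↔ hasWalkLE E u v k := by
  constructor
  · intro h
    have hne : {n : ℕ∞ | ∃ m : ℕ, hasWalk E u v m ∧ n = (m : ℕ∞)}.Nonempty := by
      by_contra hne
      rw [Set.not_nonempty_iff_eq_empty] at hne
      rw [digDist, hne, sInf_empty] at h
      exact absurd h (by simp)
    obtain ⟨m, hm, heq⟩ := csInf_mem hne
    rw [digDist, heq] at h
    exact ⟨m, by exact_mod_cast h, hm⟩
  · rintro ⟨m, hm, hw⟩
    exact (sInf_le ⟨m, hw, rfl⟩ : digDist E u v ≤ m).trans (by exact_mod_cast hm)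

theorem digReach.of_union {V : Type*} {E F : Set (V × V)} (hF : F ⊆ digTC E) {u v : V}
    (h : digReach (E ∪ F) u v) : digReach E u v := by
  induction h with
  | refl => exact .refl
  | tail _ hbc ih =>
    rcases hbc with hbc | hbc
    · exact ih.tail hbc
    · exact ih.trans (hF hbc).to_reflTransGen

theorem digReach.cond {V : Type*} {E : Set (V × V)} {u v : V} (h : digReach E u v) :
    digReach (condEdges E) (Quotient.mk (sccSetoid E) u) (Quotient.mk (sccSetoid E) v) := by
  induction h with
  | refl => exact .refl
  | @tail b c _ hbc ih =>
    by_cases heq : Quotient.mk (sccSetoid E) b = Quotient.mk (sccSetoid E) c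
    · rwa [← heq]
    · exact ih.tail ⟨heq, b, c, hbc, rfl, rfl⟩

theorem digReach_of_mk_eq {V : Type*} {E : Set (V × V)} {u v : V}
    (h : Quotient.mk (sccSetoid E) u = Quotient.mk (sccSetoid E) v) : digReach E u v :=
  (Quotient.exact h : (sccSetoid E).r u v).1

theorem digReach_out_of_cond {V : Type*} {E : Set (V × V)} {C D : Quotient (sccSetoid E)}
    (h : digReach (condEdges E) C D) : digReach E C.out D.out := by
  induction h with
  | refl => exact .refl
  | @tail B D _ hBD ih =>
    obtain ⟨-, u, v, huv, rfl, rfl⟩ := hBD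
    have hu : digReach E (Quotient.mk (sccSetoid E) u).out u :=
      digReach_of_mk_eq (Quotient.out_eq _)
    have hv : digReach E v (Quotient.mk (sccSetoid E) v).out :=
      digReach_of_mk_eq (Quotient.out_eq _).symm
    exact (ih.trans (hu.tail huv)).trans hv

/-- The non-loop pairs of `S` that are not already edges of `E`. -/
def newEdges {V : Type*} (E S : Set (V × V)) : Set (V × V) :=
  {p | p ∈ S ∧ p ∉ E ∧ p.1 ≠ p.2}

theorem newEdges_subset {V : Type*} {E S : Set (V × V)}
    (hS : ∀ p ∈ S, digReach E p.1 p.2) : newEdges E S ⊆ digTC E \ E := by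
  rintro p ⟨hp, hpE, hne⟩
  refine ⟨?_, hpE⟩
  rcases Relation.reflTransGen_iff_eq_or_transGen.1 (hS p hp) with h | h
  · exact absurd h.symm hne
  · exact h

theorem hasWalkLE_newEdges {V : Type*} {E S : Set (V × V)} {u v : V} (h : (u, v) ∈ S) :
    hasWalkLE (E ∪ newEdges E S) u v 1 := by
  by_cases hne : u = v
  · exact hne ▸ .refl _ _ _
  by_cases hE : (u, v) ∈ E
  · exact .of_edge (.inl hE)
  · exact .of_edge (.inr ⟨h, hE, hne⟩)

/-- The pairs joining each vertex, in both directions, to the representative of its strongly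
connected component, together with the lift of `Ec` to the representatives. -/
noncomputable def starLift {V : Type*} (E : Set (V × V))
    (Ec : Set (Quotient (sccSetoid E) × Quotient (sccSetoid E))) : Set (V × V) :=
  (fun p => (p.1.out, p.2.out)) '' Ec ∪
    (Set.range (fun v : V => (v, (Quotient.mk (sccSetoid E) v).out)) ∪
      Set.range (fun v : V => ((Quotient.mk (sccSetoid E) v).out, v)))

theorem ncard_starLift_le {V : Type*} [Fintype V] (E : Set (V × V))
    (Ec : Set (Quotient (sccSetoid E) × Quotient (sccSetoid E))) :
    (starLift E Ec).ncard ≤ Ec.ncard + 2 * Fintype.card V := by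
  have hrange (f : V → V × V) : (Set.range f).ncard ≤ Fintype.card V := by
    rw [← Set.image_univ, ← Nat.card_eq_fintype_card, ← Set.ncard_univ]
    exact Set.ncard_image_le
  have h₁ := Set.ncard_image_le (s := Ec) (f := fun p => (p.1.out, p.2.out)) (Set.toFinite _)
  have h₂ := hrange fun v => (v, (Quotient.mk (sccSetoid E) v).out)
  have h₃ := hrange fun v => ((Quotient.mk (sccSetoid E) v).out, v)
  refine (Set.ncard_union_le _ _).trans ?_
  have h₄ := Set.ncard_union_le (Set.range fun v : V => (v, (Quotient.mk (sccSetoid E) v).out))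
    (Set.range fun v : V => ((Quotient.mk (sccSetoid E) v).out, v))
  omega

theorem digReach_of_mem_starLift {V : Type*} {E : Set (V × V)}
    {Ec : Set (Quotient (sccSetoid E) × Quotient (sccSetoid E))}
    (hEc : Ec ⊆ digTC (condEdges E)) : ∀ p ∈ starLift E Ec, digReach E p.1 p.2 := by
  rintro _ (⟨p, hp, rfl⟩ | ⟨v, rfl⟩ | ⟨v, rfl⟩)
  · exact digReach_out_of_cond (hEc hp).to_reflTransGen
  · exact digReach_of_mk_eq (Quotient.out_eq _).symm
  · exact digReach_of_mk_eq (Quotient.out_eq _)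

theorem hasWalkLE_to_out {V : Type*} (E : Set (V × V))
    (Ec : Set (Quotient (sccSetoid E) × Quotient (sccSetoid E))) (v : V) :
    hasWalkLE (E ∪ newEdges E (starLift E Ec)) v (Quotient.mk (sccSetoid E) v).out 1 :=
  hasWalkLE_newEdges (.inr (.inl ⟨v, rfl⟩))

theorem hasWalkLE_from_out {V : Type*} (E : Set (V × V))
    (Ec : Set (Quotient (sccSetoid E) × Quotient (sccSetoid E))) (v : V) :
    hasWalkLE (E ∪ newEdges E (starLift E Ec)) (Quotient.mk (sccSetoid E) v).out v 1 :=
  hasWalkLE_newEdges (.inr (.inr ⟨v, rfl⟩))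

theorem hasWalkLE_out_of_edge {V : Type*} {E : Set (V × V)}
    {Ec : Set (Quotient (sccSetoid E) × Quotient (sccSetoid E))} {C D : Quotient (sccSetoid E)}
    (h : (C, D) ∈ condEdges E ∪ Ec) :
    hasWalkLE (E ∪ newEdges E (starLift E Ec)) C.out D.out 3 := by
  rcases h with ⟨-, u, v, huv, rfl, rfl⟩ | h
  · exact ((hasWalkLE_from_out E Ec u).trans (.of_edge (.inl huv))).trans (hasWalkLE_to_out E Ec v)
  · exact (hasWalkLE_newEdges (.inl ⟨(C, D), h, rfl⟩)).mono (by norm_num)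

theorem hasWalkLE_out {V : Type*} {E : Set (V × V)}
    {Ec : Set (Quotient (sccSetoid E) × Quotient (sccSetoid E))} {C D : Quotient (sccSetoid E)}
    {k : ℕ} (h : hasWalkLE (condEdges E ∪ Ec) C D k) :
    hasWalkLE (E ∪ newEdges E (starLift E Ec)) C.out D.out (3 * k) := by
  obtain ⟨m, hm, f, rfl, rfl, hf⟩ := h
  suffices ∀ i ≤ m, hasWalkLE (E ∪ newEdges E (starLift E Ec)) (f 0).out (f i).out (3 * i) from
    (this m le_rfl).mono (by omega)
  intro i hi
  induction i with
  | zero => exact .refl _ _ _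
  | succ i ih => exact (ih (by omega)).trans (hasWalkLE_out_of_edge (hf i (by omega)))

/-- If the condensation of an `n`-vertex digraph `G=(V,E)` admits an
`(s',d')`-shortcut, then there is `E'' ⊆ E^T∖E` with `|E''| ≤ s' + 2n` such that
`(V, E∪E'')` has diameter at most `3d' + 2`. -/
theorem stmt_16 {V : Type*} [Fintype V] (E : Set (V × V)) (hsimple : ∀ v : V, (v, v) ∉ E)
    (n : ℕ) (hn : Fintype.card V = n)
    (s' d' : ℕ) (hs' : 1 ≤ s') (hd' : 1 ≤ d')
    (h : ∃ Ec, IsShortcut (condEdges E) Ec s' d') :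
    ∃ E'' ⊆ digTC E \ E, E''.ncard ≤ s' + 2 * n ∧ diamLE (E ∪ E'') (3 * d' + 2) := by
  obtain ⟨Ec, hsub, hcard, hdiam⟩ := h
  have hnew := newEdges_subset (digReach_of_mem_starLift (hsub.trans Set.sdiff_subset))
  refine ⟨newEdges E (starLift E Ec), hnew, ?_, ?_⟩
  · have h₁ : (newEdges E (starLift E Ec)).ncard ≤ (starLift E Ec).ncard :=
      Set.ncard_le_ncard (fun p hp => hp.1) (Set.toFinite _)
    have h₂ := ncard_starLift_le E Ec
    omega
  · intro u v huv
    have hreach : digReach E u v :=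
      digReach.of_union (hnew.trans Set.sdiff_subset) huv.to_reflTransGen
    have hcond : hasWalkLE (condEdges E ∪ Ec) (Quotient.mk (sccSetoid E) u)
        (Quotient.mk (sccSetoid E) v) d' := by
      rcases Relation.reflTransGen_iff_eq_or_transGen.1 hreach.cond with h | h
      · rw [h]
        exact .refl _ _ _
      · exact digDist_le_iff.1 (hdiam _ _ (Relation.TransGen.mono (fun _ _ => Or.inl) _ _ h))
    exact digDist_le_iff.2 ((((hasWalkLE_to_out E Ec u).trans (hasWalkLE_out hcond)).trans
      (hasWalkLE_from_out E Ec v)).mono (by omega))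
end

section
/- For every real constant 0 < c < 1 there exist constants c₀, c₁ > 0 such that for every sufficiently large integer Δ there exist a K-layered digraph G=(V,E) with K = ⌈Δ^c⌉ layers, a set of pairs P, and an indexing function I, satisfying all of the following. (1) Every layer of G contains at least c₀·Δ^{10} and at most c₁·Δ^{10} vertices, and every vertex of G has in-degree at most Δ and out-degree at most Δ; denote the first layer by {s_1,…,s_{K₁}} and the last layer by {t_1,…,t_{K₂}}. (2) P ⊆ [K₁]×[K₂]; for every i∈[K₁] there are at least c₀·Δ² indices j with (i,j)∈P; for every (i,j)∈P there is exactly one directed path p_{i,j} from s_i to t_j in G; and for distinct pairs (i,j) ≠ (i',j') in P, the paths p_{i,j} and p_{i',j'} share at most one edge. (3) I assigns a value in [Δ] to every pair (v,e) where e is an in-edge or out-edge of the vertex v, in such a way that for each vertex v, I assigns distinct values to its distinct in-edges and distinct values to its distinct out-edges; and for every (x,y)∈[Δ]×[Δ] there are at least c₀·Δ^{10} pairs (i,j)∈P such that every edge (u,v) of p_{i,j} with v in an even-numbered layer has I(v,(u,v)) = x, and every edge (u,v) of p_{i,j} with u in an even-numbered layer has I(u,(u,v)) = y. -/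
/-- `p` is a directed path (with distinct vertices) from `u` to `v` in the digraph with
edge set `E`, given as its list of vertices. -/
def IsPathFrom {V : Type*} (E : Set (V × V)) (u v : V) (p : List V) : Prop :=
  p ≠ [] ∧ p.head? = some u ∧ p.getLast? = some v ∧ p.Nodup ∧
    List.Chain' (fun a b => (a, b) ∈ E) p

/-- The edges of a path given by its list of vertices. -/
def pathEdges {V : Type*} (p : List V) : Set (V × V) := {e | e ∈ p.zip p.tail}

/-- The group `ℤ/n² × ℤ/n³`, large enough that sums of at most `n` points `(a, a²)` with `a < n`
do not wrap around. -/
abbrev ParabolaGroup (n : ℕ) : Type := ZMod (n ^ 2) × ZMod (n ^ 3)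

/-- The point `(a, a²)` of the discrete parabola. -/
def parabolaPoint {n : ℕ} (a : Fin n) : ParabolaGroup n := (((a : ℕ) : ZMod _), ((a : ℕ) ^ 2 : ℕ))

/-- By strict convexity of the parabola, a sum of at most `n` of its points which equals a multiple
of one of them is a sum of equal terms. -/
theorem eq_of_sum_parabolaPoint {n : ℕ} {ι : Type*} (S : Finset ι) (hS : S.card ≤ n)
    (f g : ι → Fin n) (a : Fin n) (hg : ∀ i ∈ S, g i = a)
    (h : ∑ i ∈ S, parabolaPoint (f i) = ∑ i ∈ S, parabolaPoint (g i)) :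
    ∀ i ∈ S, f i = a := by
  have hn : 0 < n := a.pos
  replace h : ∑ i ∈ S, parabolaPoint (f i) = ∑ i ∈ S, parabolaPoint a :=
    h.trans (Finset.sum_congr rfl fun i hi => by rw [hg i hi])
  rw [Prod.ext_iff] at h
  have bound : ∀ (d : ℕ) (u : ι → Fin n), ∑ i ∈ S, (u i : ℕ) ^ (d + 1) < n ^ (d + 2) := by
    intro d u
    rcases S.eq_empty_or_nonempty with rfl | hne
    · simp; positivity
    · calc ∑ i ∈ S, (u i : ℕ) ^ (d + 1) < ∑ i ∈ S, n ^ (d + 1) :=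
            Finset.sum_lt_sum_of_nonempty hne fun i _ =>
              Nat.pow_lt_pow_left (u i).isLt (Nat.succ_ne_zero d)
        _ = S.card * n ^ (d + 1) := by simp
        _ ≤ n * n ^ (d + 1) := Nat.mul_le_mul_right _ hS
        _ = n ^ (d + 2) := by ring
  have h1 : ∑ i ∈ S, (f i : ℕ) = ∑ i ∈ S, (a : ℕ) := by
    have h1 := h.1
    simp only [Prod.fst_sum, parabolaPoint, ← Nat.cast_sum] at h1
    rw [ZMod.natCast_eq_natCast_iff'] at h1
    have b1 := bound 0 f
    have b2 := bound 0 fun _ => a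
    simp only [zero_add, pow_one] at b1 b2
    rwa [Nat.mod_eq_of_lt b1, Nat.mod_eq_of_lt b2] at h1
  have h2 : ∑ i ∈ S, (f i : ℕ) ^ 2 = ∑ i ∈ S, (a : ℕ) ^ 2 := by
    have h2 := h.2
    simp only [Prod.snd_sum, parabolaPoint, ← Nat.cast_sum] at h2
    rw [ZMod.natCast_eq_natCast_iff'] at h2
    rwa [Nat.mod_eq_of_lt (bound 1 f), Nat.mod_eq_of_lt (bound 1 fun _ => a)] at h2
  have h1z : ∑ i ∈ S, ((f i : ℕ) : ℤ) = S.card * ((a : ℕ) : ℤ) := by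
    have := congrArg (Nat.cast : ℕ → ℤ) h1
    simpa using this
  have h2z : ∑ i ∈ S, ((f i : ℕ) : ℤ) ^ 2 = S.card * ((a : ℕ) : ℤ) ^ 2 := by
    have := congrArg (Nat.cast : ℕ → ℤ) h2
    simpa using this
  have h0 : ∑ i ∈ S, (((f i : ℕ) : ℤ) - ((a : ℕ) : ℤ)) ^ 2 = 0 := by
    simp only [sub_sq, Finset.sum_add_distrib, Finset.sum_sub_distrib, ← Finset.sum_mul,
      ← Finset.mul_sum, h1z, h2z, Finset.sum_const, nsmul_eq_mul]
    ring
  rw [Finset.sum_eq_zero_iff_of_nonneg fun _ _ => sq_nonneg _] at h0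
  intro i hi
  have := sub_eq_zero.mp (pow_eq_zero_iff two_ne_zero |>.mp (h0 i hi))
  exact Fin.ext (by exact_mod_cast this)

/-- The displacement of an edge labelled `a` that leaves the `(k+1)`-st layer. -/
def layerStep {n : ℕ} (k : ℕ) (a : Fin n) : ParabolaGroup n × ParabolaGroup n :=
  if Even k then (parabolaPoint a, 0) else (0, parabolaPoint a)

/-- The sequence `x, y, x, y, …`. -/
def alternating {α : Type*} (x y : α) (k : ℕ) : α := if Even k then x else y

theorem eq_alternating_of_sum_layerStep {n : ℕ} (S : Finset ℕ) (hS : S.card ≤ n) (f : ℕ → Fin n)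
    (x y : Fin n)
    (h : ∑ k ∈ S, layerStep k (f k) = ∑ k ∈ S, layerStep k (alternating x y k)) :
    ∀ k ∈ S, f k = alternating x y k := by
  rw [Prod.ext_iff] at h
  obtain ⟨h1, h2⟩ := h
  simp only [Prod.fst_sum, Prod.snd_sum, layerStep, apply_ite Prod.fst, apply_ite Prod.snd] at h1 h2
  rw [← Finset.sum_filter, ← Finset.sum_filter] at h1
  simp only [← ite_not (Even _)] at h2
  rw [← Finset.sum_filter, ← Finset.sum_filter] at h2
  intro k hk
  by_cases hp : Even k
  · rw [alternating, if_pos hp]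
    exact eq_of_sum_parabolaPoint _ ((Finset.card_filter_le _ _).trans hS) _ _ x
      (fun i hi => if_pos (Finset.mem_filter.mp hi).2) h1 k (Finset.mem_filter.mpr ⟨hk, hp⟩)
  · rw [alternating, if_neg hp]
    exact eq_of_sum_parabolaPoint _ ((Finset.card_filter_le _ _).trans hS) _ _ y
      (fun i hi => if_neg (Finset.mem_filter.mp hi).2) h2 k (Finset.mem_filter.mpr ⟨hk, hp⟩)

theorem layerStep_injective {n : ℕ} (k : ℕ) : Function.Injective (layerStep (n := n) k) := by
  intro a b h
  have := eq_alternating_of_sum_layerStep {k} (by simpa using Nat.one_le_iff_ne_zero.mpr a.pos.ne') (fun _ => a) b b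
    (by simpa [alternating] using h) k (Finset.mem_singleton_self k)
  simpa [alternating] using this

/-- The position in layer `k + 1` of the path from `g` whose labels are `x, y, x, y, …`. -/
def alternatingPoint {n : ℕ} (g : ParabolaGroup n × ParabolaGroup n) (x y : Fin n) (k : ℕ) :
    ParabolaGroup n × ParabolaGroup n :=
  g + ∑ i ∈ Finset.range k, layerStep i (alternating x y i)

theorem alternatingPoint_add_sum_Ico {n : ℕ} (g : ParabolaGroup n × ParabolaGroup n) (x y : Fin n)
    {i j : ℕ} (hij : i ≤ j) :
    alternatingPoint g x y j =
      alternatingPoint g x y i + ∑ k ∈ Finset.Ico i j, layerStep k (alternating x y k) := by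
  rw [alternatingPoint, alternatingPoint, add_assoc, Finset.sum_range_add_sum_Ico _ hij]

/-- A path with alternating labels is determined by two of its points at distance at least two. -/
theorem labels_eq_of_alternatingPoint_eq {n : ℕ} {g g' : ParabolaGroup n × ParabolaGroup n}
    {x y x' y' : Fin n} {i j : ℕ} (hij : i + 2 ≤ j) (hj : j ≤ n)
    (hi : alternatingPoint g x y i = alternatingPoint g' x' y' i)
    (hj' : alternatingPoint g x y j = alternatingPoint g' x' y' j) :
    g = g' ∧ x = x' ∧ y = y' := by
  rw [alternatingPoint_add_sum_Ico g x y (show i ≤ j by omega),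
    alternatingPoint_add_sum_Ico g' x' y' (show i ≤ j by omega), hi, add_right_inj] at hj'
  have key := eq_alternating_of_sum_layerStep _ (by rw [Nat.card_Ico]; omega) _ _ _ hj'
  have k0 := key i (by simp; omega)
  have k1 := key (i + 1) (by simp; omega)
  have hxy : x = x' ∧ y = y' := by
    rcases Nat.even_or_odd i with he | ho
    · simp only [alternating, he, if_true, Nat.even_add_one, not_true, if_false] at k0 k1
      exact ⟨k0, k1⟩
    · have ho := Nat.not_even_iff_odd.mpr ho
      simp only [alternating, ho, Nat.even_add_one, not_false_eq_true, if_true, if_false] at k0 k1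
      exact ⟨k1, k0⟩
  obtain ⟨rfl, rfl⟩ := hxy
  exact ⟨add_right_cancel hi, rfl, rfl⟩

/-- The vertices of the layered graph: `K` copies of `(ℤ/n² × ℤ/n³)²`. -/
abbrev LayeredVertex (n K : ℕ) : Type := Fin K × (ParabolaGroup n × ParabolaGroup n)

/-- The edges of the layered graph. -/
def layeredEdges (n K : ℕ) : Set (LayeredVertex n K × LayeredVertex n K) :=
  {e | (e.2.1 : ℕ) = e.1.1 + 1 ∧ ∃ a : Fin n, e.2.2 = e.1.2 + layerStep e.1.1 a}

open Classical in
/-- The label of an edge of the layered graph. -/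
noncomputable def edgeLabel {n K : ℕ} [NeZero n] (e : LayeredVertex n K × LayeredVertex n K) :
    Fin n :=
  if h : ∃ a : Fin n, e.2.2 = e.1.2 + layerStep e.1.1 a then h.choose else 0

theorem edgeLabel_spec {n K : ℕ} [NeZero n] {e : LayeredVertex n K × LayeredVertex n K}
    (he : e ∈ layeredEdges n K) : e.2.2 = e.1.2 + layerStep e.1.1 (edgeLabel e) := by
  rw [edgeLabel, dif_pos he.2]
  exact he.2.choose_spec

theorem edgeLabel_eq {n K : ℕ} [NeZero n] {e : LayeredVertex n K × LayeredVertex n K} {a : Fin n}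
    (he : e ∈ layeredEdges n K) (ha : e.2.2 = e.1.2 + layerStep e.1.1 a) : edgeLabel e = a :=
  layerStep_injective _ (add_left_cancel ((edgeLabel_spec he).symm.trans ha))

theorem edge_eq_of_head_eq {n K : ℕ} [NeZero n] {e e' : LayeredVertex n K × LayeredVertex n K}
    (he : e ∈ layeredEdges n K) (he' : e' ∈ layeredEdges n K) (h : e.2 = e'.2)
    (hl : edgeLabel e = edgeLabel e') : e = e' := by
  have h1 := edgeLabel_spec he
  have h2 := edgeLabel_spec he'
  have hk : e.1.1 = e'.1.1 := Fin.ext (by have := he.1; have := he'.1; rw [h] at *; omega)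
  rw [h, h2, hl, hk] at h1
  exact Prod.ext (Prod.ext hk (add_right_cancel h1).symm) h

theorem edge_eq_of_tail_eq {n K : ℕ} [NeZero n] {e e' : LayeredVertex n K × LayeredVertex n K}
    (he : e ∈ layeredEdges n K) (he' : e' ∈ layeredEdges n K) (h : e.1 = e'.1)
    (hl : edgeLabel e = edgeLabel e') : e = e' := by
  have h1 := edgeLabel_spec he
  have h2 := edgeLabel_spec he'
  have hk : e.2.1 = e'.2.1 := Fin.ext (by rw [he.1, he'.1, h])
  rw [h, hl, ← h2] at h1
  exact Prod.ext h (Prod.ext hk h1)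

/-- The path from `g` in the first layer to the last layer with labels `x, y, x, y, …`. -/
def alternatingPath {n : ℕ} (K : ℕ) (g : ParabolaGroup n × ParabolaGroup n) (x y : Fin n) :
    List (LayeredVertex n K) :=
  List.ofFn fun k => (k, alternatingPoint g x y k)

theorem mem_zip_tail_iff {α : Type*} {p : List α} {e : α × α} :
    e ∈ p.zip p.tail ↔ ∃ (k : ℕ) (h : k + 1 < p.length), e = (p[k], p[k + 1]) := by
  rw [List.mem_iff_getElem]
  constructor
  · rintro ⟨k, hk, rfl⟩
    simp only [List.length_zip, List.length_tail] at hk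
    exact ⟨k, by omega, by simp⟩
  · rintro ⟨k, hk, rfl⟩
    exact ⟨k, by simp; omega, by simp⟩

theorem mem_zip_tail_alternatingPath {n K : ℕ} {g : ParabolaGroup n × ParabolaGroup n}
    {x y : Fin n} {e : LayeredVertex n K × LayeredVertex n K}
    (he : e ∈ (alternatingPath K g x y).zip (alternatingPath K g x y).tail) :
    e.2.1.val = e.1.1 + 1 ∧ e.1.2 = alternatingPoint g x y e.1.1 ∧
      e.2.2 = alternatingPoint g x y (e.1.1 + 1) := by
  obtain ⟨k, hk, rfl⟩ := mem_zip_tail_iff.mp he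
  simp [alternatingPath]

theorem mem_layeredEdges_of_alternatingPoint {n K : ℕ} {g : ParabolaGroup n × ParabolaGroup n}
    {x y : Fin n} {e : LayeredVertex n K × LayeredVertex n K}
    (he : e.2.1.val = e.1.1 + 1 ∧ e.1.2 = alternatingPoint g x y e.1.1 ∧
      e.2.2 = alternatingPoint g x y (e.1.1 + 1)) :
    e ∈ layeredEdges n K ∧ e.2.2 = e.1.2 + layerStep e.1.1 (alternating x y e.1.1) := by
  have : e.2.2 = e.1.2 + layerStep e.1.1 (alternating x y e.1.1) := by
    rw [he.2.1, he.2.2, alternatingPoint_add_sum_Ico g x y (Nat.le_succ _)]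
    simp
  exact ⟨⟨he.1, _, this⟩, this⟩

/-- The path with labels `x, y, x, y, …` is the only path between its endpoints. -/
theorem isPathFrom_layeredEdges_iff {n K : ℕ} (hK : 0 < K) (hKn : K ≤ n)
    (g : ParabolaGroup n × ParabolaGroup n) (x y : Fin n) (p : List (LayeredVertex n K)) :
    IsPathFrom (layeredEdges n K) (⟨0, hK⟩, g)
      (⟨K - 1, Nat.sub_lt hK one_pos⟩, alternatingPoint g x y (K - 1)) p ↔
    p = alternatingPath K g x y := by
  have : NeZero n := ⟨by omega⟩
  constructor
  · rintro ⟨hne, hhead, hlast, -, hchain⟩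
    have hedge : ∀ (i : ℕ) (h : i + 1 < p.length), (p[i], p[i + 1]) ∈ layeredEdges n K :=
      List.isChain_iff_getElem.mp hchain
    have hpos : 0 < p.length := List.length_pos_iff.mpr hne
    have h0 : p[0] = (⟨0, hK⟩, g) := by
      rw [List.head?_eq_getElem?, List.getElem?_eq_getElem hpos] at hhead
      exact Option.some_inj.mp hhead
    have hl : p[p.length - 1] =
        (⟨K - 1, Nat.sub_lt hK one_pos⟩, alternatingPoint g x y (K - 1)) := by
      rw [List.getLast?_eq_getElem?, List.getElem?_eq_getElem (by omega)] at hlast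
      exact Option.some_inj.mp hlast
    let f : ℕ → Fin n := fun i =>
      if h : i + 1 < p.length then edgeLabel (p[i], p[i + 1]) else 0
    have hp : ∀ (i : ℕ) (h : i < p.length), p[i].1.val = i ∧
        p[i].2 = g + ∑ k ∈ Finset.range i, layerStep k (f k) := by
      intro i
      induction i with
      | zero => intro h; simp [h0]
      | succ i ih =>
        intro h
        obtain ⟨ih1, ih2⟩ := ih (by omega)
        have he := hedge i h
        have h1 : p[i + 1].1.val = p[i].1.val + 1 := he.1
        refine ⟨by rw [h1, ih1], ?_⟩
        have h2 := edgeLabel_spec he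
        simp only [ih1, ih2] at h2
        rw [h2, Finset.sum_range_succ, add_assoc]
        simp only [f, dif_pos h]
    have hlen : p.length = K := by
      have := (hp (p.length - 1) (by omega)).1
      rw [hl] at this
      simp only at this
      omega
    have hf : ∀ k ∈ Finset.range (K - 1), f k = alternating x y k := by
      refine eq_alternating_of_sum_layerStep _ (by rw [Finset.card_range]; omega) _ _ _ ?_
      have := (hp (p.length - 1) (by omega)).2
      rw [hl] at this
      simp only [alternatingPoint, hlen] at this
      exact (add_left_cancel this).symm
    refine List.ext_getElem (by simp [alternatingPath, hlen]) fun i hi _ => ?_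
    obtain ⟨h1, h2⟩ := hp i hi
    simp only [alternatingPath, List.getElem_ofFn]
    refine Prod.ext (Fin.ext h1) (h2.trans ?_)
    simp only [alternatingPoint]
    congr 1
    refine Finset.sum_congr rfl fun k hk => ?_
    rw [Finset.mem_range] at hk
    rw [hf k (Finset.mem_range.mpr (by omega))]
  · rintro rfl
    have hlen : (alternatingPath K g x y).length = K := by simp [alternatingPath]
    refine ⟨List.ne_nil_of_length_pos (by omega), ?_, ?_, ?_, ?_⟩
    · rw [List.head?_eq_getElem?, List.getElem?_eq_getElem (by omega)]
      simp [alternatingPath, alternatingPoint]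
    · rw [List.getLast?_eq_getElem?, List.getElem?_eq_getElem (by omega)]
      simp [alternatingPath]
    · exact List.nodup_ofFn.mpr fun i j h => (Prod.ext_iff.mp h).1
    · refine List.isChain_iff_getElem.mpr fun i hi => ?_
      exact (mem_layeredEdges_of_alternatingPoint
        (mem_zip_tail_alternatingPath (mem_zip_tail_iff.mpr ⟨i, hi, rfl⟩))).1

theorem card_parabolaGroup_sq (n : ℕ) [NeZero n] :
    Nat.card (ParabolaGroup n × ParabolaGroup n) = n ^ 10 := by
  simp only [Nat.card_prod, Nat.card_zmod]
  ring

/-- Two different paths with alternating labels share at most one edge. -/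
theorem ncard_pathEdges_inter_le_one {n K : ℕ} (hK : 3 ≤ K) (hKn : K ≤ n)
    {g g' : ParabolaGroup n × ParabolaGroup n} {x y x' y' : Fin n}
    (h : ¬ (g = g' ∧ x = x' ∧ y = y')) :
    (pathEdges (alternatingPath K g x y) ∩ pathEdges (alternatingPath K g' x' y')).ncard ≤ 1 := by
  have : NeZero n := ⟨by omega⟩
  have key : ∀ e ∈ pathEdges (alternatingPath K g x y) ∩ pathEdges (alternatingPath K g' x' y'),
      ∀ e' ∈ pathEdges (alternatingPath K g x y) ∩ pathEdges (alternatingPath K g' x' y'),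
      ¬ e.1.1.val < e'.1.1.val := by
    rintro e ⟨he, he'⟩ f ⟨hf, hf'⟩ hlt
    have e1 := mem_zip_tail_alternatingPath he
    have e2 := mem_zip_tail_alternatingPath he'
    have f1 := mem_zip_tail_alternatingPath hf
    have f2 := mem_zip_tail_alternatingPath hf'
    exact h (labels_eq_of_alternatingPoint_eq (i := e.1.1) (j := f.1.1 + 1) (by omega)
      (by have := f.1.1.isLt; omega) (e1.2.1.symm.trans e2.2.1) (f1.2.2.symm.trans f2.2.2))
  refine (Set.ncard_le_one (Set.toFinite _)).mpr fun e he f hf => ?_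
  have hk : e.1.1.val = f.1.1.val := by
    have := key e he f hf
    have := key f hf e he
    omega
  have e1 := mem_zip_tail_alternatingPath he.1
  have f1 := mem_zip_tail_alternatingPath hf.1
  refine Prod.ext (Prod.ext (Fin.ext hk) ?_) (Prod.ext (Fin.ext ?_) ?_)
  · rw [e1.2.1, f1.2.1, hk]
  · rw [e1.1, f1.1, hk]
  · rw [e1.2.2, f1.2.2, hk]

theorem ncard_inNeighbors_le {n K : ℕ} [NeZero n] (v : LayeredVertex n K) :
    {u | (u, v) ∈ layeredEdges n K}.ncard ≤ n := by
  have := Set.ncard_le_ncard_of_injOn (s := {u | (u, v) ∈ layeredEdges n K}) (t := Set.univ)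
    (fun u => edgeLabel (u, v)) (fun _ _ => Set.mem_univ _)
    (fun u hu w hw h => congrArg Prod.fst (edge_eq_of_head_eq hu hw rfl h)) (Set.toFinite _)
  simpa [Set.ncard_univ] using this

theorem ncard_outNeighbors_le {n K : ℕ} [NeZero n] (v : LayeredVertex n K) :
    {u | (v, u) ∈ layeredEdges n K}.ncard ≤ n := by
  have := Set.ncard_le_ncard_of_injOn (s := {u | (v, u) ∈ layeredEdges n K}) (t := Set.univ)
    (fun u => edgeLabel (v, u)) (fun _ _ => Set.mem_univ _)
    (fun u hu w hw h => congrArg Prod.snd (edge_eq_of_tail_eq hu hw rfl h)) (Set.toFinite _)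
  simpa [Set.ncard_univ] using this

theorem ncard_layer {n K ℓ : ℕ} [NeZero n] (h1 : 1 ≤ ℓ) (hK : ℓ ≤ K) :
    {v : LayeredVertex n K | (v.1 : ℕ) + 1 = ℓ}.ncard = n ^ 10 := by
  have : {v : LayeredVertex n K | (v.1 : ℕ) + 1 = ℓ} =
      Prod.mk (⟨ℓ - 1, by omega⟩ : Fin K) '' Set.univ := by
    ext ⟨k, g⟩
    simp only [Set.mem_ofPred_eq, Set.image_univ, Set.mem_range, Prod.mk.injEq, exists_eq_right,
      Fin.ext_iff]
    omega
  rw [this, Set.ncard_image_of_injective _ (Prod.mk_right_injective _), Set.ncard_univ,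
    card_parabolaGroup_sq]

theorem eventually_layerCount_bounds {c : ℝ} (hc0 : 0 < c) (hc1 : c < 1) :
    ∃ N : ℕ, ∀ n : ℕ, N ≤ n → 3 ≤ ⌈(n : ℝ) ^ c⌉₊ ∧ ⌈(n : ℝ) ^ c⌉₊ ≤ n := by
  have h := ((tendsto_rpow_atTop hc0).comp tendsto_natCast_atTop_atTop).eventually_gt_atTop (2 : ℝ)
  obtain ⟨N, hN⟩ := Filter.eventually_atTop.mp h
  refine ⟨max N 1, fun n hn => ⟨?_, ?_⟩⟩
  · exact Nat.lt_ceil.mpr (by exact_mod_cast hN n (le_of_max_le_left hn))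
  · refine Nat.ceil_le.mpr ?_
    have h1 : (1 : ℝ) ≤ n := by exact_mod_cast le_of_max_le_right hn
    simpa using Real.rpow_le_rpow_of_exponent_le h1 hc1.le

/-- the layered geometric graph of Huang–Pettie, together with its critical
pairs `P` and indexing function `I`. Layers are numbered `1, …, K` via `layer : V → ℕ`. -/
theorem stmt_17 (c : ℝ) (hc0 : 0 < c) (hc1 : c < 1) :
    ∃ c₀ c₁ : ℝ, 0 < c₀ ∧ 0 < c₁ ∧
      ∃ Δ₀ : ℕ, ∀ Δ : ℕ, Δ₀ ≤ Δ → ∀ K : ℕ, K = ⌈(Δ : ℝ) ^ c⌉₊ →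
        ∃ (V : Type) (_ : Fintype V) (E : Set (V × V)) (layer : V → ℕ)
          (K₁ K₂ : ℕ) (s : Fin K₁ → V) (t : Fin K₂ → V)
          (P : Set (Fin K₁ × Fin K₂)) (I : V × (V × V) → Fin Δ),
          -- K-layered digraph structure
          (∀ v : V, 1 ≤ layer v ∧ layer v ≤ K) ∧
          (∀ e ∈ E, layer e.2 = layer e.1 + 1) ∧
          -- (1) layer sizes and max in/out-degree
          (∀ ℓ : ℕ, 1 ≤ ℓ → ℓ ≤ K →
            c₀ * (Δ : ℝ) ^ 10 ≤ ({v : V | layer v = ℓ}.ncard : ℝ) ∧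
            ({v : V | layer v = ℓ}.ncard : ℝ) ≤ c₁ * (Δ : ℝ) ^ 10) ∧
          (∀ v : V, {u : V | (u, v) ∈ E}.ncard ≤ Δ ∧ {u : V | (v, u) ∈ E}.ncard ≤ Δ) ∧
          -- enumerations of the first and last layers
          Function.Injective s ∧ Set.range s = {v : V | layer v = 1} ∧
          Function.Injective t ∧ Set.range t = {v : V | layer v = K} ∧
          -- (2) the pair set P and the unique paths p_{i,j}
          (∀ i : Fin K₁, c₀ * (Δ : ℝ) ^ 2 ≤ ({j : Fin K₂ | (i, j) ∈ P}.ncard : ℝ)) ∧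
          (∀ q ∈ P, ∃! p : List V, IsPathFrom E (s q.1) (t q.2) p) ∧
          (∀ q ∈ P, ∀ q' ∈ P, q ≠ q' →
            ∀ p p' : List V, IsPathFrom E (s q.1) (t q.2) p →
              IsPathFrom E (s q'.1) (t q'.2) p' →
              (pathEdges p ∩ pathEdges p').ncard ≤ 1) ∧
          -- (3) the indexing function I
          (∀ v : V, ∀ e₁ ∈ E, ∀ e₂ ∈ E, e₁.2 = v → e₂.2 = v →
            I (v, e₁) = I (v, e₂) → e₁ = e₂) ∧
          (∀ v : V, ∀ e₁ ∈ E, ∀ e₂ ∈ E, e₁.1 = v → e₂.1 = v →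
            I (v, e₁) = I (v, e₂) → e₁ = e₂) ∧
          (∀ x y : Fin Δ, c₀ * (Δ : ℝ) ^ 10 ≤
            (({q ∈ P | ∀ p : List V, IsPathFrom E (s q.1) (t q.2) p →
                ∀ e ∈ p.zip p.tail,
                  (Even (layer e.2) → I (e.2, e) = x) ∧
                  (Even (layer e.1) → I (e.1, e) = y)}).ncard : ℝ)) := by
  obtain ⟨N, hN⟩ := eventually_layerCount_bounds hc0 hc1
  refine ⟨1, 1, one_pos, one_pos, N, fun n hn K hKdef => ?_⟩
  obtain ⟨hK3, hKn⟩ : 3 ≤ K ∧ K ≤ n := hKdef ▸ hN n hn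
  have : NeZero n := ⟨by omega⟩
  have hK : 0 < K := by omega
  let G := ParabolaGroup n × ParabolaGroup n
  let φ : Fin (Fintype.card G) ≃ G := (Fintype.equivFin G).symm
  let first : Fin K := ⟨0, hK⟩
  let last : Fin K := ⟨K - 1, Nat.sub_lt hK one_pos⟩
  have hpath : ∀ (i j : Fin (Fintype.card G)) (x y : Fin n),
      φ j = alternatingPoint (φ i) x y (K - 1) → ∀ p,
      (IsPathFrom (layeredEdges n K) (first, φ i) (last, φ j) p ↔
        p = alternatingPath K (φ i) x y) := by
    intro i j x y h p
    rw [h]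
    exact isPathFrom_layeredEdges_iff hK hKn (φ i) x y p
  have hrange : ∀ k : Fin K, Set.range (fun i => ((k, φ i) : LayeredVertex n K)) =
      {v | (v.1 : ℕ) + 1 = k + 1} := by
    intro k
    ext ⟨l, g⟩
    simp only [Set.mem_range, Prod.mk.injEq, Set.mem_ofPred_eq, add_left_inj, Fin.ext_iff]
    exact ⟨fun ⟨_, h, _⟩ => h.symm, fun h => ⟨φ.symm g, h.symm, φ.apply_symm_apply g⟩⟩
  have hinj : ∀ k : Fin K, Function.Injective (fun i => ((k, φ i) : LayeredVertex n K)) :=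
    fun k i j h => φ.injective (congrArg Prod.snd h)
  refine ⟨LayeredVertex n K, inferInstance, layeredEdges n K, fun v => v.1 + 1,
    Fintype.card G, Fintype.card G, fun i => (first, φ i), fun j => (last, φ j),
    {q | ∃ x y, φ q.2 = alternatingPoint (φ q.1) x y (K - 1)}, fun z => edgeLabel z.2,
    ?_, ?_, ?_, ?_, hinj _, hrange _, hinj _, ?_, ?_, ?_, ?_, ?_, ?_, ?_⟩
  · intro v
    have := v.1.isLt
    simp only
    omega
  · intro e he
    simp only [he.1]
  · intro ℓ h1 hℓ
    simp only [ncard_layer h1 hℓ, Nat.cast_pow, one_mul, le_refl, and_self]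
  · exact fun v => ⟨ncard_inNeighbors_le v, ncard_outNeighbors_le v⟩
  · refine (hrange last).trans ?_
    simp only [last]
    rw [Nat.sub_add_cancel (show 1 ≤ K from hK)]
  · intro i
    have := Set.ncard_le_ncard_of_injOn (s := (Set.univ : Set (Fin n × Fin n)))
      (t := {j | ∃ x y, φ j = alternatingPoint (φ i) x y (K - 1)})
      (fun z => φ.symm (alternatingPoint (φ i) z.1 z.2 (K - 1)))
      (fun z _ => ⟨z.1, z.2, φ.apply_symm_apply _⟩)
      (fun z _ w _ h => by
        have := labels_eq_of_alternatingPoint_eq (i := 0) (by omega) (by omega)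
          (by simp [alternatingPoint]) (φ.symm.injective h)
        exact Prod.ext this.2.1 this.2.2) (Set.toFinite _)
    rw [Set.ncard_univ, Nat.card_prod, Nat.card_fin, ← sq] at this
    simpa using (by exact_mod_cast this : ((n : ℝ) ^ 2) ≤ _)
  · rintro ⟨i, j⟩ ⟨x, y, h⟩
    exact ⟨_, (hpath i j x y h _).mpr rfl, fun p hp => (hpath i j x y h p).mp hp⟩
  · rintro ⟨i, j⟩ ⟨x, y, h⟩ ⟨i', j'⟩ ⟨x', y', h'⟩ hne p p' hp hp'
    rw [(hpath i j x y h p).mp hp, (hpath i' j' x' y' h' p').mp hp']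
    refine ncard_pathEdges_inter_le_one hK3 hKn ?_
    rintro ⟨hg, rfl, rfl⟩
    obtain rfl := φ.injective hg
    exact hne (Prod.ext rfl (φ.injective (h.trans h'.symm)))
  · rintro v e he e' he' rfl h hl
    exact edge_eq_of_head_eq he he' h.symm hl
  · rintro v e he e' he' rfl h hl
    exact edge_eq_of_tail_eq he he' h.symm hl
  · intro x y
    rw [one_mul, ← Nat.cast_pow, Nat.cast_le, ← card_parabolaGroup_sq, ← Set.ncard_univ]
    refine Set.ncard_le_ncard_of_injOn
      (fun g => (φ.symm g, φ.symm (alternatingPoint g x y (K - 1)))) ?_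
      (fun g _ g' _ h => φ.symm.injective (congrArg Prod.fst h)) (Set.toFinite _)
    intro g _
    refine ⟨⟨x, y, by simp⟩, fun p hp e he => ?_⟩
    rw [hpath _ _ x y (by simp)] at hp
    subst hp
    have h1 := mem_zip_tail_alternatingPath he
    have h2 := mem_layeredEdges_of_alternatingPoint h1
    have hl := edgeLabel_eq h2.1 h2.2
    constructor
    · intro hev
      have hev : Even e.1.1.val := by
        simp only [h1.1] at hev
        simpa [Nat.even_add_one] using hev
      exact hl.trans (if_pos hev)
    · intro hev
      exact hl.trans (if_neg (by simpa [Nat.even_add_one] using hev))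
end
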